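/- arXiv:1705.09857 — 8 statements merged into one kernel-verified Lean document; each statement's English description precedes it below -/
import Mathlib

section
/- Let k ≥ 2 and let χ₀, χ₁, …, χ_k be k+1 nonzero linear functionals on ℝ^k such that any k of them are linearly independent (the kernels are k+1 distinct hyperplanes in general position). Assume there is no a ∈ ℝ^k with χ_i(a) > 0 for all i, and no a ∈ ℝ^k with χ_i(a) < 0 for all i. Then the family is full: for every index i there exists a ∈ ℝ^k such that χ_i(a) > 0 and χ_j(a) < 0 for every j ≠ i. -/
/-- Linearly independent functionals on a finite-dimensional space take prescribed values. -/
theorem LinearIndependent.exists_forall_dual_apply_eq {K V ι : Type*} [Field K]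
    [AddCommGroup V] [Module K V] [FiniteDimensional K V] {f : ι → V →ₗ[K] K}
    (hf : LinearIndependent K f) (c : ι → K) : ∃ v, ∀ i, f i v = c i := by
  obtain ⟨g, hg⟩ := LinearMap.exists_extend ((Module.Basis.span hf).constr K c)
  refine ⟨(Module.evalEquiv K V).symm g, fun i => ?_⟩
  rw [Module.apply_evalEquiv_symm_apply]
  have h := LinearMap.congr_fun hg (Module.Basis.span hf i)
  rw [Module.Basis.constr_basis] at h
  simpa [Module.Basis.span_apply] using h

/-- A maximal family of Lyapunov functionals (k+1 nonzero functionals on ℝ^k, any k of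
them linearly independent) without an all-positive or all-negative element is full. -/
theorem stmt0 (k : ℕ) (hk : 2 ≤ k)
    (χ : Fin (k + 1) → ((Fin k → ℝ) →ₗ[ℝ] ℝ))
    (hne : ∀ i, χ i ≠ 0)
    (hind : ∀ i : Fin (k + 1),
      LinearIndependent ℝ (fun j : {j : Fin (k + 1) // j ≠ i} => χ j))
    (hpos : ¬ ∃ a : Fin k → ℝ, ∀ i, 0 < χ i a)
    (hneg : ¬ ∃ a : Fin k → ℝ, ∀ i, χ i a < 0) :
    ∀ i : Fin (k + 1), ∃ a : Fin k → ℝ,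
      0 < χ i a ∧ ∀ j, j ≠ i → χ j a < 0 := by
  intro i
  obtain ⟨a, ha⟩ := (hind i).exists_forall_dual_apply_eq (fun _ => (-1 : ℝ))
  replace ha : ∀ j, j ≠ i → χ j a = -1 := fun j hj => ha ⟨j, hj⟩
  refine ⟨a, ?_, fun j hj => by rw [ha j hj]; norm_num⟩
  by_contra! hia
  obtain ⟨b, hb⟩ := LinearMap.surjective (hne i) (-1)
  -- A large multiple of `a` plus `b` makes every functional negative.
  set M : ℝ := ∑ j, |χ j b|
  have hM : 0 ≤ M := Finset.sum_nonneg fun j _ => abs_nonneg _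
  refine hneg ⟨(M + 1) • a + b, fun j => ?_⟩
  rw [map_add, map_smul, smul_eq_mul]
  by_cases hj : j = i
  · subst hj
    nlinarith
  · have hjM : |χ j b| ≤ M :=
      Finset.single_le_sum (f := fun j => |χ j b|) (fun j _ => abs_nonneg _) (Finset.mem_univ j)
    rw [ha j hj]
    linarith [le_abs_self (χ j b)]
end

section
/- Let χ₁, …, χ_m be finitely many nonzero linear functionals on ℝ^k. Assume the family is full: the kernels ker χ_i take at least two distinct values, and for every i there exists a ∈ ℝ^k with χ_i(a) > 0 and χ_j(a) < 0 for every j such that χ_j is not positively proportional to χ_i. Then the family is resonance free: for all indices i, j, l such that χ_i is not positively proportional to χ_j, the functional χ_i − χ_j is not a scalar multiple of χ_l. -/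
/-- `f` is positively proportional to `g`. -/
def PosProp {V : Type*} [AddCommGroup V] [Module ℝ V] (f g : V →ₗ[ℝ] ℝ) : Prop :=
  ∃ c : ℝ, 0 < c ∧ f = c • g

namespace PosProp

variable {V ι : Type*} [AddCommGroup V] [Module ℝ V] {f g : V →ₗ[ℝ] ℝ} {χ : ι → V →ₗ[ℝ] ℝ}

theorem symm (h : PosProp f g) : PosProp g f := by
  obtain ⟨c, hc, rfl⟩ := h
  exact ⟨c⁻¹, inv_pos.2 hc, (inv_smul_smul₀ hc.ne' g).symm⟩

theorem ker_eq (h : PosProp f g) : LinearMap.ker f = LinearMap.ker g := by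
  obtain ⟨c, hc, rfl⟩ := h
  exact LinearMap.ker_smul g c hc.ne'

/-- In a full family no two functionals are negatively proportional. -/
theorem ne_neg_smul_of_full
    (hker : ∃ i j, LinearMap.ker (χ i) ≠ LinearMap.ker (χ j))
    (hfull : ∀ i, ∃ a, 0 < χ i a ∧ ∀ j, ¬ PosProp (χ j) (χ i) → χ j a < 0)
    (i j : ι) {s : ℝ} (hs : s < 0) : χ j ≠ s • χ i := by
  intro h
  obtain ⟨n, hn⟩ : ∃ n, LinearMap.ker (χ i) ≠ LinearMap.ker (χ n) := by
    by_contra! hall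
    obtain ⟨p, q, hpq⟩ := hker
    exact hpq ((hall p).symm.trans (hall q))
  have hij : LinearMap.ker (χ j) = LinearMap.ker (χ i) := h ▸ LinearMap.ker_smul (χ i) s hs.ne
  obtain ⟨a, -, ha⟩ := hfull n
  have hi := ha i fun hp => hn hp.ker_eq
  have hj := ha j fun hp => hn (hij ▸ hp.ker_eq)
  rw [h, LinearMap.smul_apply, smul_eq_mul] at hj
  exact hj.not_gt (mul_pos_of_neg_of_neg hs hi)

/-- In a full family a functional is not the sum of a member not positively proportional to it
and a positive multiple of a member. -/
theorem ne_add_smul_of_full (hne : ∀ i, χ i ≠ 0)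
    (hker : ∃ i j, LinearMap.ker (χ i) ≠ LinearMap.ker (χ j))
    (hfull : ∀ i, ∃ a, 0 < χ i a ∧ ∀ j, ¬ PosProp (χ j) (χ i) → χ j a < 0)
    {i j : ι} (l : ι) (hji : ¬ PosProp (χ j) (χ i)) {c : ℝ} (hc : 0 < c) :
    χ i ≠ χ j + c • χ l := by
  intro h
  by_cases hl : PosProp (χ l) (χ i)
  · obtain ⟨t, -, hl⟩ := hl
    have hj : χ j = (1 - c * t) • χ i := by
      ext v
      have hv := LinearMap.congr_fun h v
      simp only [hl, LinearMap.add_apply, LinearMap.smul_apply, smul_eq_mul] at hv ⊢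
      linear_combination -hv
    rcases lt_trichotomy (1 - c * t) 0 with hs | hs | hs
    · exact ne_neg_smul_of_full hker hfull i j hs hj
    · exact hne j (by rw [hj, hs, zero_smul])
    · exact hji ⟨_, hs, hj⟩
  · obtain ⟨a, hi, ha⟩ := hfull i
    have hsum := LinearMap.congr_fun h a
    rw [LinearMap.add_apply, LinearMap.smul_apply, smul_eq_mul] at hsum
    linarith [ha j hji, mul_neg_of_pos_of_neg hc (ha l hl)]

end PosProp

/-- A full family of nonzero Lyapunov functionals on ℝ^k is resonance free: for all
indices i, j, l with χ_i not positively proportional to χ_j, the functional χ_i − χ_j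
is not a scalar multiple of χ_l. -/
theorem stmt2 (k m : ℕ)
    (χ : Fin m → ((Fin k → ℝ) →ₗ[ℝ] ℝ))
    (hne : ∀ i, χ i ≠ 0)
    (hker : ∃ i j : Fin m, LinearMap.ker (χ i) ≠ LinearMap.ker (χ j))
    (hfull : ∀ i : Fin m, ∃ a : Fin k → ℝ, 0 < χ i a ∧
      ∀ j : Fin m, (¬ ∃ c : ℝ, 0 < c ∧ χ j = c • χ i) → χ j a < 0) :
    ∀ i j l : Fin m, (¬ ∃ c : ℝ, 0 < c ∧ χ i = c • χ j) →
      ∀ c : ℝ, χ i - χ j ≠ c • χ l := by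
  intro i j l hij c h
  rcases lt_trichotomy c 0 with hc | rfl | hc
  · refine PosProp.ne_add_smul_of_full hne hker hfull l hij (neg_pos.2 hc) ?_
    refine LinearMap.ext fun v => ?_
    have hv := LinearMap.congr_fun h v
    simp only [LinearMap.sub_apply, LinearMap.add_apply, LinearMap.smul_apply, smul_eq_mul] at hv ⊢
    linear_combination -hv
  · rw [zero_smul] at h
    exact hij ⟨1, one_pos, by rw [one_smul]; exact sub_eq_zero.1 h⟩
  · exact PosProp.ne_add_smul_of_full hne hker hfull l (fun hp => hij hp.symm) hc
      (sub_eq_iff_eq_add'.1 h)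
end

section
/- Let k ≥ 2, r ≥ k, and let χ₁, …, χ_r be nonzero linear functionals on ℝ^k such that any k of them are linearly independent. Assume there is no a ∈ ℝ^k with χ_i(a) > 0 for all i, and no a ∈ ℝ^k with χ_i(a) < 0 for all i. Assume moreover the family is full: for every i there exists a ∈ ℝ^k with χ_i(a) > 0 and χ_j(a) < 0 for every j ≠ i. Then r = k + 1. -/
/-- Gordan's alternative: finitely many functionals with no common negative point satisfy a
convex relation. -/
theorem exists_mem_stdSimplex_sum_smul_eq_zero {ι κ : Type*} [Fintype ι] [Fintype κ]
    (χ : ι → ((κ → ℝ) →ₗ[ℝ] ℝ)) (hneg : ¬ ∃ a : κ → ℝ, ∀ i, χ i a < 0) :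
    ∃ w ∈ stdSimplex ℝ ι, ∑ i, w i • χ i = 0 := by
  classical
  let v : ι → κ → ℝ := fun i j => χ i (Pi.single j 1)
  let L : (ι → ℝ) →ₗ[ℝ] (κ → ℝ) := Fintype.linearCombination ℝ v
  by_cases h0 : (0 : κ → ℝ) ∈ L '' stdSimplex ℝ ι
  · obtain ⟨w, hw, hL⟩ := h0
    refine ⟨w, hw, LinearMap.pi_ext' fun j => LinearMap.ext_ring ?_⟩
    simpa [L, v, Fintype.linearCombination_apply] using congrFun hL j
  · exfalso
    have hconv : Convex ℝ (L '' stdSimplex ℝ ι) := (convex_stdSimplex ℝ ι).linear_image L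
    have hclosed : IsClosed (L '' stdSimplex ℝ ι) :=
      ((isCompact_stdSimplex ℝ ι).image L.continuous_of_finiteDimensional).isClosed
    obtain ⟨f, u, hf, hu⟩ := geometric_hahn_banach_closed_point hconv hclosed h0
    refine hneg ⟨fun j => f (Pi.single j 1), fun i => ?_⟩
    have hi := hf (v i) ⟨Pi.single i 1, single_mem_stdSimplex ℝ i, by simp [L]⟩
    have e1 : f (v i) = ∑ j, v i j * f (Pi.single j 1) := by
      conv_lhs => rw [pi_eq_sum_univ' (v i)]
      simp [map_sum]
    have e2 : χ i (fun j => f (Pi.single j 1)) = ∑ j, f (Pi.single j 1) * v i j := by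
      conv_lhs => rw [pi_eq_sum_univ' (fun j => f (Pi.single j 1))]
      simp [map_sum, v]
    rw [map_zero] at hu
    rw [e2]
    simp_rw [mul_comm _ (v i _)]
    linarith

/-- In a full family, a nonnegative relation with a vanishing coefficient is trivial. -/
theorem eq_zero_of_nonneg_relation {ι V : Type*} [Fintype ι] [AddCommGroup V] [Module ℝ V]
    (χ : ι → (V →ₗ[ℝ] ℝ))
    (hfull : ∀ i, ∃ a : V, 0 < χ i a ∧ ∀ j, j ≠ i → χ j a < 0)
    {w : ι → ℝ} (hw : ∀ i, 0 ≤ w i) (hrel : ∑ i, w i • χ i = 0) {i : ι} (hi : w i = 0) :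
    w = 0 := by
  obtain ⟨a, -, ha⟩ := hfull i
  have hsum : ∑ j, w j * χ j a = 0 := by simpa using LinearMap.congr_fun hrel a
  have hle : ∀ j ∈ Finset.univ, w j * χ j a ≤ 0 := fun j _ => by
    by_cases hj : j = i
    · simp [hj, hi]
    · exact mul_nonpos_of_nonneg_of_nonpos (hw j) (ha j hj).le
  funext j
  by_cases hj : j = i
  · simp [hj, hi]
  · have := (Finset.sum_eq_zero_iff_of_nonpos hle).1 hsum j (Finset.mem_univ j)
    exact (mul_eq_zero.1 this).resolve_right (ha j hj).ne

/-- A full family of r ≥ k nonzero linear functionals on ℝ^k in general position (any k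
of them linearly independent), with no all-positive and no all-negative element, must be
maximal: r = k + 1. -/
theorem stmt4 (k r : ℕ) (hk : 2 ≤ k) (hr : k ≤ r)
    (χ : Fin r → ((Fin k → ℝ) →ₗ[ℝ] ℝ))
    (hne : ∀ i, χ i ≠ 0)
    (hind : ∀ s : Finset (Fin r), s.card = k →
      LinearIndependent ℝ (fun i : s => χ i.1))
    (hpos : ¬ ∃ a : Fin k → ℝ, ∀ i, 0 < χ i a)
    (hneg : ¬ ∃ a : Fin k → ℝ, ∀ i, χ i a < 0)
    (hfull : ∀ i : Fin r, ∃ a : Fin k → ℝ,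
      0 < χ i a ∧ ∀ j, j ≠ i → χ j a < 0) :
    r = k + 1 := by
  obtain ⟨w, ⟨hw, hw1⟩, hrel⟩ := exists_mem_stdSimplex_sum_smul_eq_zero χ hneg
  have hw0 : w ≠ 0 := by
    rintro rfl
    simp at hw1
  have hwpos : ∀ i, 0 < w i := fun i => (hw i).lt_of_ne' fun h =>
    hw0 (eq_zero_of_nonneg_relation χ hfull hw hrel h)
  let i₀ : Fin r := ⟨0, by omega⟩
  have hlower : r ≠ k := by
    intro h
    have hli := hind Finset.univ (by simpa using h)
    have := Fintype.linearIndependent_iff.1 hli (fun i => w i.1)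
      (by rw [Finset.sum_coe_sort Finset.univ (fun i => w i • χ i)]; exact hrel)
      ⟨i₀, Finset.mem_univ _⟩
    exact (hwpos i₀).ne' this
  have hupper : r ≤ k + 1 := by
    by_contra! h
    let T : (Fin r → ℝ) →ₗ[ℝ] (Module.Dual ℝ (Fin k → ℝ)) × ℝ :=
      (Fintype.linearCombination ℝ χ).prod (LinearMap.proj i₀)
    have hT : LinearMap.ker T ≠ ⊥ := LinearMap.ker_ne_bot_of_finrank_lt (by
      simpa [Module.finrank_prod, Subspace.dual_finrank_eq] using h)
    obtain ⟨c, hcT, hc0⟩ := Submodule.exists_mem_ne_zero_of_ne_bot hT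
    obtain ⟨hc, hci⟩ : ∑ i, c i • χ i = 0 ∧ c i₀ = 0 := by
      simpa [T, Prod.ext_iff, Fintype.linearCombination_apply] using hcT
    have : Nonempty (Fin r) := ⟨i₀⟩
    obtain ⟨m, hm⟩ := Finite.exists_max fun i => c i / w i
    have hdiff : (c m / w m) • w - c = 0 := by
      refine eq_zero_of_nonneg_relation χ hfull (i := m) (fun i => ?_) ?_ ?_
      · simpa using (div_le_iff₀ (hwpos i)).1 (hm i)
      · change Fintype.linearCombination ℝ χ w = 0 at hrel
        change Fintype.linearCombination ℝ χ c = 0 at hc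
        change Fintype.linearCombination ℝ χ ((c m / w m) • w - c) = 0
        rw [map_sub, map_smul, hrel, hc, smul_zero, sub_zero]
      · simp [div_mul_cancel₀ _ (hwpos m).ne']
    have ht : c m / w m = 0 := by
      have := congrFun hdiff i₀
      simp only [Pi.sub_apply, Pi.smul_apply, smul_eq_mul, hci, sub_zero, Pi.zero_apply] at this
      exact (mul_eq_zero.1 this).resolve_right (hwpos i₀).ne'
    rw [ht] at hdiff
    exact hc0 (by simpa using hdiff)
  omega
end

section
/- Let χ₁, …, χ_m : ℝ^k → ℝ be nonzero linear functionals, let α be an action of the additive group ℤ^k on a nonempty set X, and let F : ℤ^k × X → ℝ satisfy the subadditivity F(a + b, x) ≤ F(a, α(b)·x) + F(b, x) for all a, b ∈ ℤ^k and x ∈ X, together with a bound F(m, x) ≤ D₂·‖m‖ for all m ∈ ℤ^k and x ∈ X, for some constant D₂ > 0 (‖·‖ the Euclidean norm). Let a ∈ ℤ^k satisfy χ_i(a) ≠ 0 for every i, with χ_i(a) > 0 for at least one i, and suppose there are constants k₀ ≥ 1 (integer), λ > 0, C₀ ≥ 1 and L ≥ 0 such that for every index i with χ_i(a) > 0, every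 integer n ≥ 1 and every x ∈ X: F(n·k₀·a, x) ≤ −n·λ + log(C₀·n^L·k₀^L·‖a‖^L) + n·k₀·χ_i(a). Then for every constant c ∈ ℝ there exist ε > 0 and N > 0 such that every b ∈ ℤ^k with ‖b‖ ≥ N and ‖a/‖a‖ − b/‖b‖‖ < ε satisfies: χ_i(b) has the same strict sign as χ_i(a) for every i, and F(b, x) < c + min{ χ_i(b) : χ_i(a) > 0 } for every x ∈ X. -/
/-- The Euclidean norm of a vector in ℝ^k. -/
noncomputable def euclNorm {k : ℕ} (v : Fin k → ℝ) : ℝ :=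
  Real.sqrt (∑ i, (v i) ^ 2)

/-- The Euclidean norm of an integer vector in ℤ^k. -/
noncomputable def znorm {k : ℕ} (m : Fin k → ℤ) : ℝ :=
  euclNorm (fun i => (m i : ℝ))

section EuclNorm

variable {k : ℕ}

theorem euclNorm_eq_norm_toLp (v : Fin k → ℝ) : euclNorm v = ‖WithLp.toLp 2 v‖ := by
  simp [euclNorm, EuclideanSpace.norm_eq]

theorem euclNorm_nonneg (v : Fin k → ℝ) : 0 ≤ euclNorm v :=
  Real.sqrt_nonneg _

theorem euclNorm_add_le (v w : Fin k → ℝ) : euclNorm (v + w) ≤ euclNorm v + euclNorm w := by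
  simpa only [euclNorm_eq_norm_toLp, WithLp.toLp_add] using norm_add_le _ _

theorem euclNorm_smul (s : ℝ) (v : Fin k → ℝ) : euclNorm (s • v) = |s| * euclNorm v := by
  simp only [euclNorm_eq_norm_toLp, WithLp.toLp_smul, norm_smul, Real.norm_eq_abs]

theorem euclNorm_pos_of_map_ne_zero (f : (Fin k → ℝ) →ₗ[ℝ] ℝ) {v : Fin k → ℝ} (hv : f v ≠ 0) :
    0 < euclNorm v := by
  rw [euclNorm_eq_norm_toLp, norm_pos_iff]
  intro h
  apply hv
  rw [(WithLp.toLp_eq_zero 2).1 h, map_zero]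

/-- A finite family of linear functionals is uniformly bounded for the Euclidean norm. -/
theorem exists_abs_le_mul_euclNorm {ι : Type*} [Finite ι] (χ : ι → ((Fin k → ℝ) →ₗ[ℝ] ℝ)) :
    ∃ M : ℝ, 0 ≤ M ∧ ∀ i v, |χ i v| ≤ M * euclNorm v := by
  cases nonempty_fintype ι
  let g : ι → (EuclideanSpace ℝ (Fin k) →L[ℝ] ℝ) := fun i =>
    LinearMap.toContinuousLinearMap (χ i ∘ₗ (WithLp.linearEquiv 2 ℝ (Fin k → ℝ)).toLinearMap)
  refine ⟨∑ i, ‖g i‖, Finset.sum_nonneg fun i _ => norm_nonneg _, fun i v => ?_⟩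
  have hle : ‖g i‖ ≤ ∑ j, ‖g j‖ :=
    Finset.single_le_sum (f := fun j => ‖g j‖) (fun j _ => norm_nonneg _) (Finset.mem_univ i)
  rw [euclNorm_eq_norm_toLp]
  exact ((g i).le_opNorm (WithLp.toLp 2 v)).trans
    (mul_le_mul_of_nonneg_right hle (norm_nonneg _))

/-- If the directions of `v` and `w` are `ε`-close, then subtracting from `w` the multiple `s • v`
leaves a remainder controlled by `ε` and by the difference of the lengths of `w` and `s • v`. -/
theorem euclNorm_sub_smul_le {v w : Fin k → ℝ} (hv : 0 < euclNorm v) (hw : 0 < euclNorm w)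
    {ε : ℝ} (h : euclNorm (fun t => v t / euclNorm v - w t / euclNorm w) ≤ ε) (s : ℝ) :
    euclNorm (w - s • v) ≤ euclNorm w * ε + |euclNorm w - s * euclNorm v| := by
  have hdec : w - s • v =
      (-euclNorm w) • (fun t => v t / euclNorm v - w t / euclNorm w) +
        (euclNorm w / euclNorm v - s) • v := by
    ext t
    simp only [Pi.add_apply, Pi.sub_apply, Pi.smul_apply, smul_eq_mul]
    field_simp
    ring
  have hlen : |euclNorm w / euclNorm v - s| * euclNorm v = |euclNorm w - s * euclNorm v| := by
    rw [← abs_of_pos hv, ← abs_mul, abs_of_pos hv]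
    congr 1
    field_simp
  calc euclNorm (w - s • v) ≤ _ := hdec ▸ euclNorm_add_le _ _
    _ = euclNorm w * euclNorm (fun t => v t / euclNorm v - w t / euclNorm w) +
        |euclNorm w - s * euclNorm v| := by
      rw [euclNorm_smul, euclNorm_smul, hlen, abs_neg, abs_of_pos hw]
    _ ≤ _ := by gcongr

/-- If the directions of `v` and `w` are `ε`-close, then so are the values of a bounded functional
on them, after normalization. -/
theorem abs_map_div_sub_map_div_le {f : (Fin k → ℝ) →ₗ[ℝ] ℝ} {M : ℝ}
    (hf : ∀ u, |f u| ≤ M * euclNorm u) (v w : Fin k → ℝ) :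
    |f v / euclNorm v - f w / euclNorm w| ≤
      M * euclNorm (fun t => v t / euclNorm v - w t / euclNorm w) := by
  have hdec : (fun t => v t / euclNorm v - w t / euclNorm w) =
      (euclNorm v)⁻¹ • v - (euclNorm w)⁻¹ • w := by
    ext t
    simp [div_eq_inv_mul]
  have := hf (fun t => v t / euclNorm v - w t / euclNorm w)
  rw [hdec] at this ⊢
  simpa [map_sub, map_smul, div_eq_inv_mul] using this

end EuclNorm

theorem exists_forall_neg_mul_add_log_rpow_add_lt {C μ : ℝ} (hC : 0 < C) (hμ : 0 < μ)
    (L K c : ℝ) :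
    ∃ n₀ : ℕ, 1 ≤ n₀ ∧ ∀ n : ℕ, n₀ ≤ n →
      -(n : ℝ) * μ + Real.log (C * (n : ℝ) ^ L) + K < c := by
  have hlog : (fun x : ℝ => L * Real.log x) =o[Filter.atTop] (fun x : ℝ => x) :=
    Real.isLittleO_log_id_atTop.const_mul_left L
  have hev := tendsto_natCast_atTop_atTop.eventually (hlog.bound (half_pos hμ))
  have hbig := (tendsto_natCast_atTop_atTop (R := ℝ)).eventually
    (Filter.eventually_gt_atTop ((Real.log C + K - c) / (μ / 2)))
  obtain ⟨n₁, h₁⟩ := Filter.eventually_atTop.1 (hev.and hbig)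
  refine ⟨max n₁ 1, le_max_right _ _, fun n hn => ?_⟩
  obtain ⟨hsmall, hlarge⟩ := h₁ n ((le_max_left _ _).trans hn)
  have hn0 : (0 : ℝ) < n := by exact_mod_cast (le_max_right n₁ 1).trans hn
  rw [Real.log_mul hC.ne' (Real.rpow_pos_of_pos hn0 L).ne', Real.log_rpow hn0]
  rw [Real.norm_eq_abs, Real.norm_eq_abs, abs_of_pos hn0] at hsmall
  rw [div_lt_iff₀ (half_pos hμ)] at hlarge
  linarith [le_abs_self (L * Real.log n)]

/-- Quantitative robustness of the set of bunched elements: if a subadditive, linearly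
bounded quantity F over a ℤ^k action decays along the multiples of k₀·a below every
positive Lyapunov functional, then every b of large norm whose direction is close to
that of a lies in the same Weyl chamber as a and satisfies
F(b,·) < c + min{χ_i(b) : χ_i(a) > 0}. -/
theorem stmt5 (k m : ℕ) {X : Type*} [Nonempty X]
    (χ : Fin m → ((Fin k → ℝ) →ₗ[ℝ] ℝ)) (hχ : ∀ i, χ i ≠ 0)
    (α : (Fin k → ℤ) → X → X)
    (hα0 : ∀ x, α 0 x = x)
    (hαadd : ∀ a b x, α (a + b) x = α a (α b x))
    (F : (Fin k → ℤ) → X → ℝ)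
    (hsub : ∀ a b x, F (a + b) x ≤ F a (α b x) + F b x)
    (D₂ : ℝ) (hD₂ : 0 < D₂)
    (hbound : ∀ m' x, F m' x ≤ D₂ * znorm m')
    (a : Fin k → ℤ)
    (haR : ∀ i, χ i (fun t => (a t : ℝ)) ≠ 0)
    (hsome : ∃ i, 0 < χ i (fun t => (a t : ℝ)))
    (k₀ : ℕ) (hk₀ : 1 ≤ k₀) (lam : ℝ) (hlam : 0 < lam)
    (C₀ : ℝ) (hC₀ : 1 ≤ C₀) (L : ℝ) (hL : 0 ≤ L)
    (hdecay : ∀ i, 0 < χ i (fun t => (a t : ℝ)) → ∀ n : ℕ, 1 ≤ n → ∀ x,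
      F (((n : ℤ) * (k₀ : ℤ)) • a) x ≤
        -(n : ℝ) * lam
          + Real.log (C₀ * (n : ℝ) ^ L * (k₀ : ℝ) ^ L * (znorm a) ^ L)
          + (n : ℝ) * (k₀ : ℝ) * χ i (fun t => (a t : ℝ))) :
    ∀ c : ℝ, ∃ ε > (0 : ℝ), ∃ N > (0 : ℝ), ∀ b : Fin k → ℤ,
      N ≤ znorm b →
      euclNorm (fun t => (a t : ℝ) / znorm a - (b t : ℝ) / znorm b) < ε →
      (∀ i, (0 < χ i (fun t => (a t : ℝ)) → 0 < χ i (fun t => (b t : ℝ))) ∧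
        (χ i (fun t => (a t : ℝ)) < 0 → χ i (fun t => (b t : ℝ)) < 0)) ∧
      (∀ x, ∀ i, 0 < χ i (fun t => (a t : ℝ)) →
        F b x < c + χ i (fun t => (b t : ℝ))) := by
  intro c
  obtain ⟨i₀, hi₀⟩ := hsome
  have hA : 0 < znorm a := euclNorm_pos_of_map_ne_zero _ (haR i₀)
  have hk : (0 : ℝ) < k₀ := by exact_mod_cast hk₀
  obtain ⟨M, hM, hχM⟩ := exists_abs_le_mul_euclNorm χ
  obtain ⟨j, -, hj⟩ := Finset.exists_min_image Finset.univ
    (fun i => |χ i (fun t => (a t : ℝ))|) ⟨i₀, Finset.mem_univ _⟩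
  have hδ : 0 < |χ j (fun t => (a t : ℝ))| := abs_pos.2 (haR j)
  set δ := |χ j (fun t => (a t : ℝ))|
  set P := k₀ * znorm a with hP
  have hPpos : 0 < P := mul_pos hk hA
  have hDM : 0 < D₂ + M := by linarith
  obtain ⟨n₀, hn₀, hlt⟩ := exists_forall_neg_mul_add_log_rpow_add_lt
    (C := C₀ * (k₀ : ℝ) ^ L * (znorm a) ^ L) (by positivity) (half_pos hlam) L
    (lam / 2 + (D₂ + M) * P) c
  refine ⟨min (lam / (2 * ((D₂ + M) * P))) (δ / (znorm a * (M + 1))), by positivity,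
    n₀ * P, by positivity, fun b hbN hbε => ?_⟩
  obtain ⟨hε₁, hε₂⟩ := lt_min_iff.1 hbε
  have hR : 0 < znorm b := lt_of_lt_of_le (by positivity) hbN
  refine ⟨fun i => ?_, fun x i hi => ?_⟩
  · have hclose := abs_map_div_sub_map_div_le (hχM i) (fun t => (a t : ℝ)) (fun t => (b t : ℝ))
    change |_ / znorm a - _ / znorm b| ≤
      M * euclNorm (fun t => (a t : ℝ) / znorm a - (b t : ℝ) / znorm b) at hclose
    have hlt' : |χ i (fun t => (a t : ℝ)) / znorm a - χ i (fun t => (b t : ℝ)) / znorm b| <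
        |χ i (fun t => (a t : ℝ))| / znorm a := by
      rw [lt_div_iff₀ (by positivity)] at hε₂
      rw [lt_div_iff₀ hA]
      have hmin := hj i (Finset.mem_univ i)
      have hE : 0 ≤ euclNorm (fun t => (a t : ℝ) / znorm a - (b t : ℝ) / znorm b) :=
        euclNorm_nonneg _
      nlinarith [mul_le_mul_of_nonneg_right hclose hA.le, mul_nonneg hE hA.le]
    constructor
    · intro hpos
      rw [abs_of_pos hpos] at hlt'
      have : 0 < χ i (fun t => (b t : ℝ)) / znorm b := by linarith [(abs_lt.1 hlt').2]
      exact (div_pos_iff_of_pos_right hR).1 this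
    · intro hneg
      rw [abs_of_neg hneg, neg_div] at hlt'
      have : χ i (fun t => (b t : ℝ)) / znorm b < 0 := by linarith [(abs_lt.1 hlt').1]
      simpa using (div_lt_iff₀ hR).1 this
  · set n := ⌊znorm b / P⌋₊
    have hn : n₀ ≤ n := Nat.le_floor ((le_div_iff₀ hPpos).2 hbN)
    have hfloor_le : n * P ≤ znorm b :=
      (le_div_iff₀ hPpos).1 (Nat.floor_le (by positivity))
    have hlt_floor : znorm b < (n + 1) * P := (div_lt_iff₀ hPpos).1 (Nat.lt_floor_add_one _)
    set q : Fin k → ℤ := ((n : ℤ) * (k₀ : ℤ)) • a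
    have hcast : (fun t => ((b - q) t : ℝ)) =
        (fun t => (b t : ℝ)) - ((n : ℝ) * k₀) • (fun t => (a t : ℝ)) := by
      ext t
      simp [q]
    have hr := euclNorm_sub_smul_le (v := fun t => (a t : ℝ)) (w := fun t => (b t : ℝ)) hA hR
      hε₁.le (n * k₀)
    rw [← hcast] at hr
    change znorm (b - q) ≤ znorm b * _ + |znorm b - n * k₀ * znorm a| at hr
    rw [mul_assoc (n : ℝ), ← hP, abs_of_nonneg (by linarith)] at hr
    have hr' : (D₂ + M) * znorm (b - q) ≤ (n + 1) * (lam / 2) + (D₂ + M) * P := by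
      calc (D₂ + M) * znorm (b - q)
          ≤ (D₂ + M) * ((n + 1) * P * (lam / (2 * ((D₂ + M) * P))) + P) := by
            gcongr
            refine hr.trans (add_le_add ?_ (by linarith))
            gcongr
        _ = _ := by field_simp
    have hχr := neg_le_of_abs_le (hχM i (fun t => ((b - q) t : ℝ)))
    change -(M * znorm (b - q)) ≤ _ at hχr
    rw [hcast, map_sub, map_smul, smul_eq_mul] at hχr
    have hF := hsub q (b - q) x
    rw [add_sub_cancel] at hF
    have hFq := hdecay i hi n (hn₀.trans hn) (α (b - q) x)
    have hFr := hbound (b - q) x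
    have hfin := hlt n hn
    rw [show C₀ * (k₀ : ℝ) ^ L * (znorm a) ^ L * (n : ℝ) ^ L =
      C₀ * (n : ℝ) ^ L * (k₀ : ℝ) ^ L * (znorm a) ^ L by ring] at hfin
    linarith
end

section
/- Let a ∈ ℝ^k be nonzero, let k₀ ≥ 1 be an integer, and let ε ∈ (0, 1/2). There exists N > 0 such that for every b ∈ ℝ^k with ‖b‖ ≥ N and ‖a/‖a‖ − b/‖b‖‖ < ε, if n₀ ∈ ℤ minimizes n ↦ ‖b − n·k₀·a‖ over n ∈ ℤ, then n₀ ≥ 1 and ‖b − n₀·k₀·a‖ < 2·ε·n₀·k₀·‖a‖. -/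
/-- Geometric estimate: if b has large norm and direction ε-close to that of a, then
the closest element n₀·k₀·a of the arithmetic progression k₀·ℤ·a to b satisfies n₀ ≥ 1
and ‖b − n₀·k₀·a‖ < 2ε·n₀·k₀·‖a‖. -/
theorem stmt6 (k : ℕ) (a : EuclideanSpace ℝ (Fin k)) (ha : a ≠ 0)
    (k₀ : ℕ) (hk₀ : 1 ≤ k₀) (ε : ℝ) (hε : ε ∈ Set.Ioo (0 : ℝ) (1 / 2)) :
    ∃ N > (0 : ℝ), ∀ b : EuclideanSpace ℝ (Fin k), N ≤ ‖b‖ →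
      ‖‖a‖⁻¹ • a - ‖b‖⁻¹ • b‖ < ε →
      ∀ n₀ : ℤ,
        (∀ n : ℤ, ‖b - (((n₀ * (k₀ : ℤ)) : ℤ) : ℝ) • a‖ ≤
          ‖b - (((n * (k₀ : ℤ)) : ℤ) : ℝ) • a‖) →
        1 ≤ n₀ ∧
          ‖b - (((n₀ * (k₀ : ℤ)) : ℤ) : ℝ) • a‖ <
            2 * ε * (n₀ : ℝ) * (k₀ : ℝ) * ‖a‖ := by
  obtain ⟨hε0, hε1⟩ := hε
  have hA : 0 < ‖a‖ := norm_pos_iff.mpr ha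
  have hk : (0 : ℝ) < k₀ := by exact_mod_cast hk₀
  obtain ⟨d, hd⟩ : ∃ d : ℝ, d = k₀ * ‖a‖ := ⟨_, rfl⟩
  have hd0 : 0 < d := hd ▸ mul_pos hk hA
  have hc : 0 < ε * (1 - 2 * ε) := mul_pos hε0 (by linarith)
  have hN : 0 < 2 * d / (ε * (1 - 2 * ε)) := by positivity
  refine ⟨2 * d / (ε * (1 - 2 * ε)), hN, fun b hb hab n₀ hmin => ?_⟩
  have hB : 0 < ‖b‖ := hN.trans_le hb
  rw [div_le_iff₀ hc] at hb
  have hproj : ‖b - (‖b‖ / ‖a‖) • a‖ < ε * ‖b‖ := by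
    have h : b - (‖b‖ / ‖a‖) • a = -(‖b‖ • (‖a‖⁻¹ • a - ‖b‖⁻¹ • b)) := by
      rw [smul_sub, smul_smul, smul_smul, mul_inv_cancel₀ hB.ne', one_smul, neg_sub,
        div_eq_mul_inv]
    rw [h, norm_neg, norm_smul, norm_norm, mul_comm]
    exact mul_lt_mul_of_pos_right hab hB
  have hdist (n : ℤ) :
      ‖(‖b‖ / ‖a‖) • a - (((n * (k₀ : ℤ)) : ℤ) : ℝ) • a‖ = |‖b‖ - n * d| := by
    rw [← sub_smul, norm_smul, Real.norm_eq_abs, ← abs_of_pos hA, ← abs_mul, abs_of_pos hA, hd]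
    congr 1
    push_cast
    field_simp
  have hM : ‖b - (((n₀ * (k₀ : ℤ)) : ℤ) : ℝ) • a‖ < ε * ‖b‖ + d := by
    have hfloor : |‖b‖ - ⌊‖b‖ / d⌋ * d| ≤ d := by
      have h₁ := (le_div_iff₀ hd0).mp (Int.floor_le (‖b‖ / d))
      have h₂ := (div_lt_iff₀ hd0).mp (Int.lt_floor_add_one (‖b‖ / d))
      rw [abs_le]
      constructor <;> linarith
    have htri := norm_sub_le_norm_sub_add_norm_sub b ((‖b‖ / ‖a‖) • a)
      ((((⌊‖b‖ / d⌋ * (k₀ : ℤ)) : ℤ) : ℝ) • a)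
    rw [hdist] at htri
    linarith [hmin ⌊‖b‖ / d⌋]
  have hlower : (1 - 2 * ε) * ‖b‖ - d < n₀ * d := by
    have htri := norm_sub_le_norm_sub_add_norm_sub ((‖b‖ / ‖a‖) • a) b
      ((((n₀ * (k₀ : ℤ)) : ℤ) : ℝ) • a)
    rw [hdist, norm_sub_rev _ b] at htri
    linarith [le_abs_self (‖b‖ - n₀ * d)]
  have hn₀ : 0 < (n₀ : ℝ) := by
    refine pos_of_mul_pos_left (b := d) ?_ hd0.le
    nlinarith [mul_pos (show 0 < 1 - 2 * ε by linarith) hB]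
  have hnorm : ‖b‖ ≤ ‖b - (((n₀ * (k₀ : ℤ)) : ℤ) : ℝ) • a‖ + n₀ * d := by
    have h : ‖(((n₀ * (k₀ : ℤ)) : ℤ) : ℝ) • a‖ = n₀ * d := by
      rw [norm_smul, Real.norm_eq_abs, Int.cast_mul, Int.cast_natCast,
        abs_of_pos (mul_pos hn₀ hk), hd, mul_assoc]
    linarith [norm_le_norm_sub_add b ((((n₀ * (k₀ : ℤ)) : ℤ) : ℝ) • a)]
  refine ⟨by exact_mod_cast hn₀, ?_⟩
  rw [mul_assoc _ (k₀ : ℝ), ← hd, mul_assoc]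
  nlinarith [mul_lt_mul_of_pos_left hM hε0, mul_le_mul_of_nonneg_left hnorm hε0.le,
    mul_pos hd0 (sub_pos.mpr hε1)]
end

section
/- Let E and F be real normed vector spaces, P a nonempty index set, and fix constants χ ∈ ℝ, c ≥ 1, L ≥ 0 and λ ∈ (0, 1). For every integer n ≥ 1 and every p ∈ P, let A_n(p) : E → E, C_n(p) : E → F and D_n(p) : F → F be continuous linear maps satisfying: (i) c⁻¹·e^(n·χ)·‖u‖ ≤ ‖A_n(p)·u‖ ≤ c·n^L·e^(n·χ)·‖u‖ for all u ∈ E; (ii) ‖D_n(p)·v‖ ≤ λ^n · (inf over unit u of ‖A_n(p)·u‖) · ‖v‖ for all v ∈ F; (iii) S_n := sup over p ∈ P of ‖C_n(p)‖ is finite. Then there exist an integer l ≥ 1, a constant γ > 0 and ε ∈ (0, 1) such that for every p ∈ P and every pair (u, v) ∈ E × F with ‖v‖ ≤ γ·‖u‖, one has ‖C_l(p)·u + D_l(p)·v‖ ≤ (1 − ε)·γ·‖A_l(p)·u‖. -/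
/-- If the norm of `D` is at most `r` times the conorm of `A`, then `‖D v‖ ≤ r * γ * ‖A u‖`
on the cone `‖v‖ ≤ γ * ‖u‖`. -/
theorem norm_apply_le_of_conorm_domination {E F : Type*} [NormedAddCommGroup E] [NormedSpace ℝ E]
    [NormedAddCommGroup F] [NormedSpace ℝ F] {A : E →L[ℝ] E} {D : F →L[ℝ] F} {r γ : ℝ}
    (hr : 0 ≤ r) (hD : ∀ v u, ‖u‖ = 1 → ‖D v‖ ≤ r * ‖A u‖ * ‖v‖) {u : E} {v : F}
    (huv : ‖v‖ ≤ γ * ‖u‖) : ‖D v‖ ≤ r * γ * ‖A u‖ := by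
  rcases eq_or_ne u 0 with rfl | hu
  · have hv : v = 0 := by simpa using huv
    simp [hv]
  have hu0 : ‖u‖ ≠ 0 := norm_ne_zero_iff.mpr hu
  calc ‖D v‖ ≤ r * ‖A (‖u‖⁻¹ • u)‖ * ‖v‖ := hD v _ (by simp [norm_smul, hu0])
    _ ≤ r * ‖A (‖u‖⁻¹ • u)‖ * (γ * ‖u‖) := by gcongr
    _ = r * γ * ‖A u‖ := by
      rw [map_smul, norm_smul, norm_inv, norm_norm]
      field_simp

/-- Cone lemma for the partially hyperbolic extension: given block families
(A_n, C_n, D_n) with polynomial-deviation exponential bounds on A_n, domination of D_n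
by λⁿ times the conorm of A_n, and uniformly bounded C_n, there are l ≥ 1, γ > 0 and
ε ∈ (0,1) such that the cone {‖v‖ ≤ γ‖u‖} is mapped strictly into the cone
{‖v‖ ≤ (1−ε)γ‖u‖}. -/
theorem stmt7 {E F : Type*} [NormedAddCommGroup E] [NormedSpace ℝ E]
    [NormedAddCommGroup F] [NormedSpace ℝ F]
    {P : Type*} [Nonempty P]
    (χ c L lam : ℝ) (hc : 1 ≤ c) (hL : 0 ≤ L) (hlam : lam ∈ Set.Ioo (0 : ℝ) 1)
    (A : ℕ → P → E →L[ℝ] E) (C : ℕ → P → E →L[ℝ] F) (D : ℕ → P → F →L[ℝ] F)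
    (hA : ∀ n : ℕ, 1 ≤ n → ∀ p u,
      c⁻¹ * Real.exp ((n : ℝ) * χ) * ‖u‖ ≤ ‖A n p u‖ ∧
      ‖A n p u‖ ≤ c * (n : ℝ) ^ L * Real.exp ((n : ℝ) * χ) * ‖u‖)
    (hD : ∀ n : ℕ, 1 ≤ n → ∀ p v u, ‖u‖ = 1 →
      ‖D n p v‖ ≤ lam ^ n * ‖A n p u‖ * ‖v‖)
    (hC : ∀ n : ℕ, 1 ≤ n → ∃ S : ℝ, ∀ p, ‖C n p‖ ≤ S) :
    ∃ l : ℕ, 1 ≤ l ∧ ∃ γ > (0 : ℝ), ∃ ε ∈ Set.Ioo (0 : ℝ) 1,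
      ∀ p u v, ‖v‖ ≤ γ * ‖u‖ →
        ‖C l p u + D l p v‖ ≤ (1 - ε) * γ * ‖A l p u‖ := by
  obtain ⟨hlam0, hlam1⟩ := hlam
  obtain ⟨S, hS⟩ := hC 1 le_rfl
  have hc0 : 0 < c := by linarith
  set m := c⁻¹ * Real.exp (((1 : ℕ) : ℝ) * χ)
  have hm0 : 0 < m := by positivity
  set K := (|S| + 1) / m with hK
  have hK0 : 0 < K := by positivity
  have hγ0 : 0 < 2 * K / (1 - lam) := div_pos (by linarith) (by linarith)
  refine ⟨1, le_rfl, 2 * K / (1 - lam), hγ0, (1 - lam) / 2,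
    ⟨by linarith, by linarith⟩, fun p u v huv => ?_⟩
  set γ := 2 * K / (1 - lam) with hγ
  have hCu : ‖C 1 p u‖ ≤ K * ‖A 1 p u‖ := calc
    ‖C 1 p u‖ ≤ ‖C 1 p‖ * ‖u‖ := (C 1 p).le_opNorm u
    _ ≤ (|S| + 1) * ‖u‖ := by
      gcongr
      linarith [hS p, le_abs_self S]
    _ = K * (m * ‖u‖) := by rw [hK]; field_simp
    _ ≤ K * ‖A 1 p u‖ := by
      gcongr
      exact (hA 1 le_rfl p u).1
  have hDv : ‖D 1 p v‖ ≤ lam * γ * ‖A 1 p u‖ :=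
    norm_apply_le_of_conorm_domination hlam0.le (fun v u hu => by simpa using hD 1 le_rfl p v u hu)
      huv
  have hγK : K = (1 - lam) / 2 * γ := by
    have : 1 - lam ≠ 0 := by linarith
    rw [hγ]
    field_simp
  calc ‖C 1 p u + D 1 p v‖ ≤ K * ‖A 1 p u‖ + lam * γ * ‖A 1 p u‖ :=
        norm_add_le_of_le hCu hDv
    _ = (1 - (1 - lam) / 2) * γ * ‖A 1 p u‖ := by rw [hγK]; ring
end

section
/- Let E and F be real normed vector spaces and endow E × F with the norm ‖(u, v)‖ = max(‖u‖, ‖v‖). Let A : E → E, C : E → F and D : F → F be continuous linear maps and define T : E × F → E × F by T(u, v) = (A·u, C·u + D·v). Let γ > 0, suppose m := inf{‖A·u‖ : u ∈ E, ‖u‖ = 1} > 0, and suppose T maps the cone C_γ := {(u, v) ∈ E × F : ‖v‖ ≤ γ·‖u‖} into itself. Then for every w ∈ C_γ one has max(1, γ)⁻¹ · m · ‖w‖ ≤ ‖T·w‖ ≤ max(1, γ) · ‖A‖ · ‖w‖. -/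
/-- The infimum of `‖A u‖` over unit vectors is a lower growth bound for `A`. -/
lemma sInf_norm_unit_mul_norm_le {E F : Type*} [NormedAddCommGroup E] [NormedSpace ℝ E]
    [NormedAddCommGroup F] [NormedSpace ℝ F] (A : E →L[ℝ] F) (u : E) :
    sInf {r : ℝ | ∃ u : E, ‖u‖ = 1 ∧ r = ‖A u‖} * ‖u‖ ≤ ‖A u‖ := by
  rcases eq_or_ne u 0 with rfl | hu
  · simp
  · have hbdd : BddBelow {r : ℝ | ∃ u : E, ‖u‖ = 1 ∧ r = ‖A u‖} :=
      ⟨0, by rintro r ⟨x, -, rfl⟩; exact norm_nonneg _⟩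
    have h := csInf_le hbdd ⟨‖u‖⁻¹ • u, norm_smul_inv_norm (𝕜 := ℝ) hu, rfl⟩
    rw [map_smul, norm_smul, norm_inv, norm_norm] at h
    rwa [← le_div_iff₀ (norm_pos_iff.mpr hu), div_eq_inv_mul]

/-- On the cone `‖v‖ ≤ γ * ‖u‖` the norm is controlled by the first component. -/
lemma Prod.norm_le_max_one_mul_norm_fst {E F : Type*} [SeminormedAddCommGroup E]
    [SeminormedAddCommGroup F] {γ : ℝ} {w : E × F} (hw : ‖w.2‖ ≤ γ * ‖w.1‖) :
    ‖w‖ ≤ max 1 γ * ‖w.1‖ := by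
  rw [Prod.norm_def]
  refine max_le ?_ (hw.trans ?_)
  · exact le_mul_of_one_le_left (norm_nonneg _) (le_max_left _ _)
  · gcongr
    exact le_max_right _ _

/-- Uniform transversality estimate: for the block-triangular map
T(u,v) = (A u, C u + D v) preserving the cone C_γ = {‖v‖ ≤ γ‖u‖}, the growth of T on
the cone agrees with the growth of A up to the constant max(1, γ). Here E × F carries
the sup norm ‖(u,v)‖ = max(‖u‖, ‖v‖) and m is the infimum of ‖A u‖ over unit u. -/
theorem stmt8 {E F : Type*} [NormedAddCommGroup E] [NormedSpace ℝ E]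
    [NormedAddCommGroup F] [NormedSpace ℝ F]
    (A : E →L[ℝ] E) (C : E →L[ℝ] F) (D : F →L[ℝ] F)
    (T : E × F → E × F) (hT : ∀ w : E × F, T w = (A w.1, C w.1 + D w.2))
    (γ : ℝ) (hγ : 0 < γ)
    (m : ℝ) (hm : m = sInf {r : ℝ | ∃ u : E, ‖u‖ = 1 ∧ r = ‖A u‖})
    (hmpos : 0 < m)
    (hcone : ∀ w : E × F, ‖w.2‖ ≤ γ * ‖w.1‖ → ‖(T w).2‖ ≤ γ * ‖(T w).1‖) :
    ∀ w : E × F, ‖w.2‖ ≤ γ * ‖w.1‖ →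
      (max 1 γ)⁻¹ * m * ‖w‖ ≤ ‖T w‖ ∧ ‖T w‖ ≤ max 1 γ * ‖A‖ * ‖w‖ := by
  intro w hw
  have hM : 0 < max 1 γ := lt_max_of_lt_left one_pos
  have hfst : (T w).1 = A w.1 := by rw [hT]
  constructor
  · calc (max 1 γ)⁻¹ * m * ‖w‖ ≤ (max 1 γ)⁻¹ * m * (max 1 γ * ‖w.1‖) := by
          gcongr
          exact Prod.norm_le_max_one_mul_norm_fst hw
      _ = m * ‖w.1‖ := by field_simp
      _ ≤ ‖A w.1‖ := hm ▸ sInf_norm_unit_mul_norm_le A w.1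
      _ ≤ ‖T w‖ := hfst ▸ norm_fst_le (T w)
  · calc ‖T w‖ ≤ max 1 γ * ‖A w.1‖ :=
          hfst ▸ Prod.norm_le_max_one_mul_norm_fst (hcone w hw)
      _ ≤ max 1 γ * (‖A‖ * ‖w‖) := by
          gcongr
          exact A.le_opNorm_of_le (norm_fst_le w)
      _ = max 1 γ * ‖A‖ * ‖w‖ := by ring
end

section
/- Let k ≥ 2 and let χ₁, …, χ_m be nonzero linear functionals on ℝ^k. Assume that for every pair (i, j) such that χ_i is not a scalar multiple of χ_j, the functional χ_i − χ_j is not a scalar multiple of any χ_l (l = 1, …, m). Then there exists a 2-dimensional linear subspace P ⊆ ℝ^k such that: (a) P ∩ ker χ_i is 1-dimensional for every i; (b) P ∩ ker χ_i ≠ P ∩ ker χ_j whenever ker χ_i ≠ ker χ_j; and (c) for every nonzero b ∈ P ∩ ker χ₁ and every pair (i, j) with χ_i not a scalar multiple of χ_j, one has χ_i(b) ≠ χ_j(b). -/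
section GeneralPosition

variable {K V : Type*} [Field K] [AddCommGroup V] [Module K V]

/-- A functional that is not a multiple of `g` does not vanish on all of `ker g`. -/
lemma exists_mem_ker_apply_ne_zero {f g : V →ₗ[K] K} (h : ¬ ∃ c : K, f = c • g) :
    ∃ v ∈ LinearMap.ker g, f v ≠ 0 := by
  contrapose! h
  have hspan : f ∈ Submodule.span K (Set.range fun _ : Unit => g) :=
    mem_span_of_iInf_ker_le_ker (by simpa [SetLike.le_def] using h)
  obtain ⟨c, hc⟩ := Submodule.mem_span_singleton.1 (by simpa using hspan)
  exact ⟨c, hc.symm⟩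

/-- A hyperplane not containing `P` cuts the dimension of `P` by one. -/
lemma finrank_inf_ker_add_one [FiniteDimensional K V] {P : Submodule K V} {f : V →ₗ[K] K} {u : V}
    (hu : u ∈ P) (hfu : f u ≠ 0) :
    Module.finrank K ↥(P ⊓ LinearMap.ker f) + 1 = Module.finrank K P := by
  have hne : f ∘ₗ P.subtype ≠ 0 := fun h => hfu (LinearMap.congr_fun h ⟨u, hu⟩)
  rw [← Module.Dual.finrank_ker_add_one_of_ne_zero hne, LinearMap.ker_comp,
    ← Submodule.map_comap_subtype, Submodule.finrank_map_subtype_eq]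

lemma exists_mem_ker_ne_zero [FiniteDimensional K V] (hV : 2 ≤ Module.finrank K V)
    (g : V →ₗ[K] K) : ∃ v ∈ LinearMap.ker g, v ≠ 0 := by
  refine (Submodule.ne_bot_iff _).1 fun h => ?_
  have := LinearMap.finrank_le_finrank_of_injective (LinearMap.ker_eq_bot.1 h)
  rw [Module.finrank_self] at this
  omega

/-- If `g u ≠ 0` and `f₁`, `f₂` are not proportional, then the functional `f₂ u • f₁ - f₁ u • f₂`
is not a multiple of `g`. -/
lemma not_exists_smul_sub_smul_eq_smul {f₁ f₂ g : V →ₗ[K] K} {u : V} (hg : g u ≠ 0)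
    (h₂ : f₂ u ≠ 0) (h : ¬ ∃ c : K, f₁ = c • f₂) :
    ¬ ∃ c : K, f₂ u • f₁ - f₁ u • f₂ = c • g := by
  rintro ⟨c, hc⟩
  have hcu := LinearMap.congr_fun hc u
  have hc0 : c = 0 := by
    simpa [hg, mul_comm (f₂ u)] using hcu.symm
  rw [hc0, zero_smul, sub_eq_zero] at hc
  exact h ⟨(f₂ u)⁻¹ * f₁ u, by rw [mul_smul, ← hc, inv_smul_smul₀ h₂]⟩

end GeneralPosition

/-- For a resonance-free family of nonzero linear functionals χ₀, χ₁, …, χ_m on ℝ^k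
(k ≥ 2) there is a 2-dimensional subspace P in general position: P meets each kernel
in a line, distinct kernels meet P in distinct lines, and on every nonzero vector of
the line P ∩ ker χ₀ all pairwise non-proportional functionals take distinct values. -/
theorem stmt13 (k m : ℕ) (hk : 2 ≤ k)
    (χ : Fin (m + 1) → ((Fin k → ℝ) →ₗ[ℝ] ℝ))
    (hne : ∀ i, χ i ≠ 0)
    (hres : ∀ i j : Fin (m + 1), (¬ ∃ c : ℝ, χ i = c • χ j) →
      ∀ l : Fin (m + 1), ∀ c : ℝ, χ i - χ j ≠ c • χ l) :
    ∃ P : Submodule ℝ (Fin k → ℝ),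
      Module.finrank ℝ ↥P = 2 ∧
      (∀ i, Module.finrank ℝ ↥(P ⊓ LinearMap.ker (χ i)) = 1) ∧
      (∀ i j, LinearMap.ker (χ i) ≠ LinearMap.ker (χ j) →
        P ⊓ LinearMap.ker (χ i) ≠ P ⊓ LinearMap.ker (χ j)) ∧
      (∀ b : Fin k → ℝ, b ∈ P ⊓ LinearMap.ker (χ 0) → b ≠ 0 →
        ∀ i j, (¬ ∃ c : ℝ, χ i = c • χ j) → χ i b ≠ χ j b) := by
  obtain ⟨u, hu⟩ := Module.Dual.exists_forall_ne_zero_of_forall_exists χ fun i =>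
    DFunLike.ne_iff.1 (hne i)
  let N := {p : Fin (m + 1) × Fin (m + 1) // ¬ ∃ c : ℝ, χ p.1 = c • χ p.2}
  obtain ⟨b₁, hb₁, hb₁0⟩ := exists_mem_ker_ne_zero (by simpa using hk) (χ 0)
  obtain ⟨t, ht⟩ := Function.ne_iff.1 hb₁0
  let F : (N ⊕ N) ⊕ Unit → ((Fin k → ℝ) →ₗ[ℝ] ℝ) :=
    Sum.elim
      (Sum.elim (fun p => χ p.1.1 - χ p.1.2)
        (fun p => χ p.1.2 u • χ p.1.1 - χ p.1.1 u • χ p.1.2))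
      (fun _ => LinearMap.proj t)
  obtain ⟨b, hb, hFb⟩ : ∃ b ∈ LinearMap.ker (χ 0), ∀ x, F x b ≠ 0 := by
    refine Module.Dual.exists_forall_mem_ne_zero_of_forall_exists (LinearMap.ker (χ 0)) F ?_
    rintro ((⟨⟨i, j⟩, hij⟩ | ⟨⟨i, j⟩, hij⟩) | _)
    · exact exists_mem_ker_apply_ne_zero fun ⟨c, hc⟩ => hres i j hij 0 c hc
    · exact exists_mem_ker_apply_ne_zero
        (not_exists_smul_sub_smul_eq_smul (hu 0) (hu j) hij)
    · exact ⟨b₁, hb₁, ht⟩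
  have hb0 : b ≠ 0 := by
    rintro rfl
    exact hFb (Sum.inr ()) (map_zero _)
  rw [LinearMap.mem_ker] at hb
  have huP : u ∈ Submodule.span ℝ {u, b} := Submodule.subset_span (by simp)
  have hbP : b ∈ Submodule.span ℝ {u, b} := Submodule.subset_span (by simp)
  have hind : LinearIndependent ℝ ![u, b] := by
    refine LinearIndependent.pair_iff.2 fun s r h => ?_
    have hs : s = 0 := by simpa [hb, hu 0] using congrArg (χ 0) h
    subst hs
    simpa [hb0] using h
  have hP : Module.finrank ℝ (Submodule.span ℝ {u, b}) = 2 := by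
    rw [← Matrix.range_cons_cons_empty u b ![], finrank_span_eq_card hind, Fintype.card_fin]
  refine ⟨Submodule.span ℝ {u, b}, hP, fun i => ?_, fun i j hij heq => ?_,
    fun v hv hv0 i j hij heq => ?_⟩
  · have := finrank_inf_ker_add_one huP (hu i)
    omega
  · have hprop : ¬ ∃ c : ℝ, χ i = c • χ j := by
      rintro ⟨c, hc⟩
      have hc0 : c ≠ 0 := by
        rintro rfl
        exact hne i (by simpa using hc)
      exact hij (by rw [hc, LinearMap.ker_smul _ _ hc0])
    have hw : χ i u • b - χ i b • u ∈ Submodule.span ℝ {u, b} ⊓ LinearMap.ker (χ i) :=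
      ⟨sub_mem (Submodule.smul_mem _ _ hbP) (Submodule.smul_mem _ _ huP), by
        simp [mul_comm]⟩
    rw [heq] at hw
    have hwj : χ i u * χ j b - χ i b * χ j u = 0 := by simpa using hw.2
    apply hFb (Sum.inl (Sum.inr ⟨(i, j), hprop⟩))
    simp only [F, Sum.elim_inl, Sum.elim_inr, LinearMap.sub_apply, LinearMap.smul_apply,
      smul_eq_mul]
    linarith
  · obtain ⟨s, r, rfl⟩ := Submodule.mem_span_pair.1 hv.1
    have hs : s = 0 := by simpa [hb, hu 0] using hv.2
    subst hs
    have hr : r ≠ 0 := by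
      rintro rfl
      simp at hv0
    apply hFb (Sum.inl (Sum.inl ⟨(i, j), hij⟩))
    simpa [F, hr, sub_eq_zero] using heq
end
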